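/- Let T > 0 and let u : ℝ×ℝ → ℝ (u = u(x,t)) be smooth. Suppose that for every test function ψ on ℝ×(0,T), ∫₀^T ∫_ℝ { u·(ψ_t + u ψ_x − ψ u_x) + u_x·(ψ_tx + u ψ_xx − ψ u_xx) } dx dt = 0. Then u satisfies the Camassa–Holm equation with parameter κ = 0, i.e. u_t + 3u u_x − u_txx = 2 u_x u_xx + u u_xxx at every point (x,t) ∈ ℝ×(0,T). (This is the precise Eulerian weak form of the paper's Theorem 1: criticality of the right-invariant kinetic-energy action forces the horizontal velocity of an irrotational unidirectional shallow water flow to satisfy the Camassa–Holm equation.) -/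

import Mathlib

open MeasureTheory Set

/-- Partial derivative in the first (spatial) variable `x` of `u = u(x,t)`. -/
noncomputable def pdx (u : ℝ × ℝ → ℝ) : ℝ × ℝ → ℝ :=
  fun p => deriv (fun x => u (x, p.2)) p.1

/-- Partial derivative in the second (time) variable `t` of `u = u(x,t)`. -/
noncomputable def pdt (u : ℝ × ℝ → ℝ) : ℝ × ℝ → ℝ :=
  fun p => deriv (fun t => u (p.1, t)) p.2

/-- A test function on `ℝ × (0,T)`: smooth, compactly supported, with support
contained in `ℝ × (0,T)`. -/
def IsTestFun (T : ℝ) (ψ : ℝ × ℝ → ℝ) : Prop :=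
  ContDiff ℝ (⊤ : ℕ∞) ψ ∧ HasCompactSupport ψ ∧ tsupport ψ ⊆ univ ×ˢ Ioo 0 T

theorem pdx_eq_fderiv {f : ℝ × ℝ → ℝ} (hf : ContDiff ℝ (⊤ : ℕ∞) f) :
    pdx f = fun p => fderiv ℝ f p (1, 0) := by
  funext p
  have h : HasDerivAt (fun x : ℝ => (x, p.2)) ((1 : ℝ), (0 : ℝ)) p.1 :=
    (hasDerivAt_id p.1).prodMk (hasDerivAt_const p.1 p.2)
  exact (((hf.differentiable (by simp)) p).hasFDerivAt.comp_hasDerivAt p.1 h).deriv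

theorem pdt_eq_fderiv {f : ℝ × ℝ → ℝ} (hf : ContDiff ℝ (⊤ : ℕ∞) f) :
    pdt f = fun p => fderiv ℝ f p (0, 1) := by
  funext p
  have h : HasDerivAt (fun t : ℝ => (p.1, t)) ((0 : ℝ), (1 : ℝ)) p.2 :=
    (hasDerivAt_const p.2 p.1).prodMk (hasDerivAt_id p.2)
  exact (((hf.differentiable (by simp)) p).hasFDerivAt.comp_hasDerivAt p.2 h).deriv

theorem contDiff_fderiv_apply_const {f : ℝ × ℝ → ℝ} (hf : ContDiff ℝ (⊤ : ℕ∞) f) (v : ℝ × ℝ) :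
    ContDiff ℝ (⊤ : ℕ∞) (fun p => fderiv ℝ f p v) :=
  (hf.fderiv_right (m := (⊤ : ℕ∞)) (by simp)).clm_apply contDiff_const

theorem contDiff_pdx {f : ℝ × ℝ → ℝ} (hf : ContDiff ℝ (⊤ : ℕ∞) f) :
    ContDiff ℝ (⊤ : ℕ∞) (pdx f) := by
  rw [pdx_eq_fderiv hf]; exact contDiff_fderiv_apply_const hf _

theorem contDiff_pdt {f : ℝ × ℝ → ℝ} (hf : ContDiff ℝ (⊤ : ℕ∞) f) :
    ContDiff ℝ (⊤ : ℕ∞) (pdt f) := by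
  rw [pdt_eq_fderiv hf]; exact contDiff_fderiv_apply_const hf _

theorem tsupport_pdx_subset {f : ℝ × ℝ → ℝ} (hf : ContDiff ℝ (⊤ : ℕ∞) f) :
    tsupport (pdx f) ⊆ tsupport f := by
  rw [pdx_eq_fderiv hf]; exact tsupport_fderiv_apply_subset ℝ _

theorem tsupport_pdt_subset {f : ℝ × ℝ → ℝ} (hf : ContDiff ℝ (⊤ : ℕ∞) f) :
    tsupport (pdt f) ⊆ tsupport f := by
  rw [pdt_eq_fderiv hf]; exact tsupport_fderiv_apply_subset ℝ _

theorem IsTestFun.pdx {T : ℝ} {ψ : ℝ × ℝ → ℝ} (h : IsTestFun T ψ) : IsTestFun T (pdx ψ) :=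
  ⟨contDiff_pdx h.1, h.2.1.of_isClosed_subset (isClosed_tsupport _) (tsupport_pdx_subset h.1),
    (tsupport_pdx_subset h.1).trans h.2.2⟩

theorem IsTestFun.pdt {T : ℝ} {ψ : ℝ × ℝ → ℝ} (h : IsTestFun T ψ) : IsTestFun T (pdt ψ) :=
  ⟨contDiff_pdt h.1, h.2.1.of_isClosed_subset (isClosed_tsupport _) (tsupport_pdt_subset h.1),
    (tsupport_pdt_subset h.1).trans h.2.2⟩

theorem IsTestFun.integrable_mul {T : ℝ} {f ψ : ℝ × ℝ → ℝ} (h : IsTestFun T ψ)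
    (hf : Continuous f) : Integrable (fun p => f p * ψ p) :=
  (hf.mul h.1.continuous).integrable_of_hasCompactSupport h.2.1.mul_left

theorem IsTestFun.eq_zero_of_notMem {T : ℝ} {ψ : ℝ × ℝ → ℝ} (h : IsTestFun T ψ)
    (x : ℝ) {t : ℝ} (ht : t ∉ Ioo 0 T) : ψ (x, t) = 0 :=
  image_eq_zero_of_notMem_tsupport fun hm => ht (h.2.2 hm).2

theorem pdx_mul {f g : ℝ × ℝ → ℝ} (hf : ContDiff ℝ (⊤ : ℕ∞) f) (hg : ContDiff ℝ (⊤ : ℕ∞) g) :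
    pdx (fun p => f p * g p) = fun p => pdx f p * g p + f p * pdx g p := by
  rw [pdx_eq_fderiv (hf.mul hg), pdx_eq_fderiv hf, pdx_eq_fderiv hg]
  funext p
  rw [fderiv_fun_mul (hf.differentiable (by simp) p) (hg.differentiable (by simp) p)]
  simp only [add_apply, smul_apply, smul_eq_mul]
  ring

theorem pdx_add {f g : ℝ × ℝ → ℝ} (hf : ContDiff ℝ (⊤ : ℕ∞) f) (hg : ContDiff ℝ (⊤ : ℕ∞) g) :
    pdx (fun p => f p + g p) = fun p => pdx f p + pdx g p := by
  rw [pdx_eq_fderiv (hf.add hg), pdx_eq_fderiv hf, pdx_eq_fderiv hg]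
  funext p
  rw [fderiv_fun_add (hf.differentiable (by simp) p) (hg.differentiable (by simp) p)]
  rfl

theorem pdt_pdx_comm {f : ℝ × ℝ → ℝ} (hf : ContDiff ℝ (⊤ : ℕ∞) f) :
    pdt (pdx f) = pdx (pdt f) := by
  rw [pdt_eq_fderiv (contDiff_pdx hf), pdx_eq_fderiv (contDiff_pdt hf), pdx_eq_fderiv hf,
    pdt_eq_fderiv hf]
  funext p
  have hd : DifferentiableAt ℝ (fderiv ℝ f) p :=
    (hf.fderiv_right (m := (⊤ : ℕ∞)) (by simp)).differentiable (by simp) p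
  have key (v w : ℝ × ℝ) :
      fderiv ℝ (fun q => fderiv ℝ f q v) p w = fderiv ℝ (fderiv ℝ f) p w v := by
    rw [fderiv_clm_apply hd (differentiableAt_const v)]
    simp
  rw [key, key]
  exact (hf.contDiffAt.isSymmSndFDerivAt (by simpa using (WithTop.coe_le_coe.2 (le_top : (2 : ℕ∞) ≤ ⊤)))).eq _ _

theorem IsTestFun.integral_mul_fderiv {T : ℝ} {f ψ : ℝ × ℝ → ℝ} (h : IsTestFun T ψ)
    (hf : ContDiff ℝ (⊤ : ℕ∞) f) (v : ℝ × ℝ) :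
    ∫ p, f p * fderiv ℝ ψ p v = -∫ p, fderiv ℝ f p v * ψ p :=
  integral_mul_fderiv_eq_neg_fderiv_mul_of_integrable
    (h.integrable_mul (contDiff_fderiv_apply_const hf v).continuous)
    ((hf.continuous.mul
      (contDiff_fderiv_apply_const h.1 v).continuous).integrable_of_hasCompactSupport
      (h.2.1.fderiv_apply ℝ v).mul_left)
    (h.integrable_mul hf.continuous)
    (fun p _ => hf.differentiable (by simp) p) (fun p _ => h.1.differentiable (by simp) p)

theorem IsTestFun.integral_mul_pdx {T : ℝ} {f ψ : ℝ × ℝ → ℝ} (h : IsTestFun T ψ)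
    (hf : ContDiff ℝ (⊤ : ℕ∞) f) : ∫ p, f p * _root_.pdx ψ p = -∫ p, _root_.pdx f p * ψ p := by
  rw [pdx_eq_fderiv hf, pdx_eq_fderiv h.1]
  exact h.integral_mul_fderiv hf _

theorem IsTestFun.integral_mul_pdt {T : ℝ} {f ψ : ℝ × ℝ → ℝ} (h : IsTestFun T ψ)
    (hf : ContDiff ℝ (⊤ : ℕ∞) f) : ∫ p, f p * _root_.pdt ψ p = -∫ p, _root_.pdt f p * ψ p := by
  rw [pdt_eq_fderiv hf, pdt_eq_fderiv h.1]
  exact h.integral_mul_fderiv hf _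

theorem integral_add_add_sub_add_add_sub {α : Type*} [MeasurableSpace α] {μ : Measure α}
    {f₁ f₂ f₃ f₄ f₅ f₆ : α → ℝ} (h₁ : Integrable f₁ μ) (h₂ : Integrable f₂ μ)
    (h₃ : Integrable f₃ μ) (h₄ : Integrable f₄ μ) (h₅ : Integrable f₅ μ) (h₆ : Integrable f₆ μ) :
    ∫ a, (f₁ a + f₂ a - f₃ a + f₄ a + f₅ a - f₆ a) ∂μ =
      ∫ a, f₁ a ∂μ + ∫ a, f₂ a ∂μ - ∫ a, f₃ a ∂μ + ∫ a, f₄ a ∂μ + ∫ a, f₅ a ∂μ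
        - ∫ a, f₆ a ∂μ := by
  have h := integral_sub' ((((h₁.add h₂).sub h₃).add h₄).add h₅) h₆
  rwa [integral_add' (((h₁.add h₂).sub h₃).add h₄) h₅, integral_add' ((h₁.add h₂).sub h₃) h₄,
    integral_sub' (h₁.add h₂) h₃, integral_add' h₁ h₂] at h

/-- The first-variation functional, integrated by parts against a test function. -/
theorem IsTestFun.firstVariation_eq {T : ℝ} {u ψ : ℝ × ℝ → ℝ} (h : IsTestFun T ψ)
    (hu : ContDiff ℝ (⊤ : ℕ∞) u) :
    (∫ t in Ioo (0:ℝ) T, ∫ x : ℝ,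
          (u (x, t) * (_root_.pdt ψ (x, t) + u (x, t) * _root_.pdx ψ (x, t)
              - ψ (x, t) * _root_.pdx u (x, t))
            + _root_.pdx u (x, t) * (_root_.pdx (_root_.pdt ψ) (x, t)
                + u (x, t) * _root_.pdx (_root_.pdx ψ) (x, t)
                - ψ (x, t) * _root_.pdx (_root_.pdx u) (x, t)))) =
      ∫ p, ψ p * (2 * _root_.pdx u p * _root_.pdx (_root_.pdx u) p
            + u p * _root_.pdx (_root_.pdx (_root_.pdx u)) p
            - (_root_.pdt u p + 3 * u p * _root_.pdx u p
              - _root_.pdx (_root_.pdx (_root_.pdt u)) p)) := by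
  have hux := contDiff_pdx hu
  have huxx := contDiff_pdx hux
  have huux := hu.mul hux
  have i₁ := h.pdt.integrable_mul hu.continuous
  have i₂ := h.pdx.integrable_mul (hu.mul hu).continuous
  have i₃ := h.integrable_mul huux.continuous
  have i₄ := h.pdt.pdx.integrable_mul hux.continuous
  have i₅ := h.pdx.pdx.integrable_mul huux.continuous
  have i₆ := h.integrable_mul (hux.mul huxx).continuous
  have e₁ := h.integral_mul_pdt hu
  have e₂ := h.integral_mul_pdx (hu.mul hu)
  have e₄ := h.pdt.integral_mul_pdx hux
  rw [h.integral_mul_pdt huxx, neg_neg, pdt_pdx_comm hux, pdt_pdx_comm hu] at e₄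
  have e₅ := h.pdx.integral_mul_pdx huux
  rw [h.integral_mul_pdx (contDiff_pdx huux), neg_neg] at e₅
  have j₁ := h.integrable_mul (contDiff_pdt hu).continuous
  have j₂ := h.integrable_mul (contDiff_pdx (hu.mul hu)).continuous
  have j₄ := h.integrable_mul (contDiff_pdx (contDiff_pdx (contDiff_pdt hu))).continuous
  have j₅ := h.integrable_mul (contDiff_pdx (contDiff_pdx huux)).continuous
  rw [setIntegral_eq_integral_of_forall_compl_eq_zero fun t ht => by
    simp [h.eq_zero_of_notMem _ ht, h.pdt.eq_zero_of_notMem _ ht, h.pdx.eq_zero_of_notMem _ ht,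
      h.pdt.pdx.eq_zero_of_notMem _ ht, h.pdx.pdx.eq_zero_of_notMem _ ht]]
  have hI : Integrable fun p : ℝ × ℝ =>
      u p * (_root_.pdt ψ p + u p * _root_.pdx ψ p - ψ p * _root_.pdx u p)
        + _root_.pdx u p * (_root_.pdx (_root_.pdt ψ) p + u p * _root_.pdx (_root_.pdx ψ) p
          - ψ p * _root_.pdx (_root_.pdx u) p) := by
    convert ((((i₁.add i₂).sub i₃).add i₄).add i₅).sub i₆ using 1
    funext p
    simp only [Pi.add_apply, Pi.sub_apply]
    ring
  rw [Measure.volume_eq_prod] at hI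
  refine (integral_prod_symm _ hI).symm.trans ?_
  rw [← Measure.volume_eq_prod]
  have hL := integral_add_add_sub_add_add_sub i₁ i₂ i₃ i₄ i₅ i₆
  have hR := integral_add_add_sub_add_add_sub j₁.neg j₂.neg i₃ j₄ j₅ i₆
  simp only [Pi.neg_apply, integral_neg] at hR
  rw [e₁, e₂, e₄, e₅, ← hR] at hL
  convert hL using 1
  · congr 1
    funext p
    ring
  · congr 1
    funext p
    rw [pdx_mul hu hux, pdx_add (hux.mul hux) (hu.mul huxx), pdx_mul hux hux, pdx_mul hu huxx,
      pdx_mul hu hu]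
    ring

/-- Theorem 1 (weak Eulerian form): if the smooth `u` annihilates the first-variation
functional against every test function on `ℝ × (0,T)`, then `u` satisfies the
Camassa–Holm equation with `κ = 0` on `ℝ × (0,T)`. -/
theorem camassaHolm_of_weak_irrotational
    (T : ℝ) (hT : 0 < T) (u : ℝ × ℝ → ℝ) (hu : ContDiff ℝ (⊤ : ℕ∞) u)
    (hweak : ∀ ψ : ℝ × ℝ → ℝ, IsTestFun T ψ →
      (∫ t in Ioo (0:ℝ) T, ∫ x : ℝ,
          (u (x, t) * (pdt ψ (x, t) + u (x, t) * pdx ψ (x, t) - ψ (x, t) * pdx u (x, t))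
            + pdx u (x, t) * (pdx (pdt ψ) (x, t) + u (x, t) * pdx (pdx ψ) (x, t)
                - ψ (x, t) * pdx (pdx u) (x, t)))) = 0) :
    ∀ x : ℝ, ∀ t ∈ Ioo (0:ℝ) T,
      pdt u (x, t) + 3 * u (x, t) * pdx u (x, t) - pdx (pdx (pdt u)) (x, t)
        = 2 * pdx u (x, t) * pdx (pdx u) (x, t)
            + u (x, t) * pdx (pdx (pdx u)) (x, t) := by
  have hux := contDiff_pdx hu
  have hc : Continuous fun p => 2 * pdx u p * pdx (pdx u) p + u p * pdx (pdx (pdx u)) p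
      - (pdt u p + 3 * u p * pdx u p - pdx (pdx (pdt u)) p) := by
    have h₀ := hu.continuous
    have h₁ := hux.continuous
    have h₂ := (contDiff_pdx hux).continuous
    have h₃ := (contDiff_pdx (contDiff_pdx hux)).continuous
    have h₄ := (contDiff_pdt hu).continuous
    have h₅ := (contDiff_pdx (contDiff_pdx (contDiff_pdt hu))).continuous
    fun_prop
  have hU : IsOpen ((univ : Set ℝ) ×ˢ Ioo 0 T) := isOpen_univ.prod isOpen_Ioo
  have hae := hU.ae_eq_zero_of_integral_contDiff_smul_eq_zero
    (μ := volume) (hc.locallyIntegrable.locallyIntegrableOn _) fun ψ h₁ h₂ h₃ => by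
      have h : IsTestFun T ψ := ⟨h₁, h₂, h₃⟩
      exact (h.firstVariation_eq hu).symm.trans (hweak ψ h)
  have heq := Measure.eqOn_open_of_ae_eq
    ((ae_restrict_iff' hU.measurableSet).2 hae) hU hc.continuousOn continuousOn_const
  intro x t ht
  exact (sub_eq_zero.1 (heq (show (x, t) ∈ univ ×ˢ Ioo 0 T from ⟨mem_univ _, ht⟩))).symm
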